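/- The entropies of the greedy prefix distributions are strictly increasing, H(q^1) < H(q^2) < … < H(q^n) = H(p), so H(q^j) < H(p) for every j < n and the entropy is maximized only when all tokens are selected. Consequently, if H(p) > 0 and 0 < α < 1, then there exists an index j ≤ n with H(q^j) > α·H(p), and hence the greedy algorithm that adds tokens in descending probability order and stops when the entropy constraint H(q^j) ≤ α·H(p) would be violated terminates having selected a proper subset of {1,…,n}. -/

import Mathlib

/-- `Γ_j = Σ_{i=1}^{j} p_i` (1-based indexing). -/
noncomputable def Gam (p : ℕ → ℝ) (j : ℕ) : ℝ := ∑ i ∈ Finset.Icc 1 j, p i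

/-- Shannon entropy `H(q^j)` of the truncated distribution `q^j(i) = p_i / Γ_j`
on the first `j` indices. -/
noncomputable def Hq (p : ℕ → ℝ) (j : ℕ) : ℝ :=
  -∑ i ∈ Finset.Icc 1 j, (p i / Gam p j) * Real.log (p i / Gam p j)

/-- Shannon entropy `H(p)` of the full distribution `(p_1,…,p_n)`. -/
noncomputable def Hp (p : ℕ → ℝ) (n : ℕ) : ℝ :=
  -∑ i ∈ Finset.Icc 1 n, p i * Real.log (p i)

/-- The entropy of a truncated distribution in terms of the unnormalized weights. -/
theorem Hq_eq_log_sub (p : ℕ → ℝ) (j : ℕ) (hp : ∀ i ∈ Finset.Icc 1 j, 0 < p i)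
    (hG : 0 < Gam p j) :
    Hq p j = Real.log (Gam p j) -
      (∑ i ∈ Finset.Icc 1 j, p i * Real.log (p i)) / Gam p j := by
  have hterm : ∀ i ∈ Finset.Icc 1 j, p i / Gam p j * Real.log (p i / Gam p j) =
      p i * Real.log (p i) / Gam p j - p i * (Real.log (Gam p j) / Gam p j) := by
    intro i hi
    rw [Real.log_div (hp i hi).ne' hG.ne']
    ring
  have hsum : ∑ i ∈ Finset.Icc 1 j, p i = Gam p j := rfl
  rw [Hq, Finset.sum_congr rfl hterm, Finset.sum_sub_distrib, ← Finset.sum_div,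
    ← Finset.sum_mul, hsum, mul_div_cancel₀ _ hG.ne']
  ring

/-- Appending a positive weight that is at most all previous weights strictly increases the
entropy of the normalized distribution. -/
theorem Hq_lt_Hq_succ (p : ℕ → ℝ) (j : ℕ) (hj : 1 ≤ j) (hx : 0 < p (j + 1))
    (hle : ∀ i ∈ Finset.Icc 1 j, p (j + 1) ≤ p i) : Hq p j < Hq p (j + 1) := by
  have hp : ∀ i ∈ Finset.Icc 1 j, 0 < p i := fun i hi => hx.trans_le (hle i hi)
  have hG : 0 < Gam p j := Finset.sum_pos hp (Finset.nonempty_Icc.2 hj)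
  have hsucc : Gam p (j + 1) = Gam p j + p (j + 1) :=
    Finset.sum_Icc_succ_top (by omega) _
  have hG' : 0 < Gam p (j + 1) := by rw [hsucc]; positivity
  have hp' : ∀ i ∈ Finset.Icc 1 (j + 1), 0 < p i := by
    intro i hi
    rw [Finset.mem_Icc] at hi
    rcases hi.2.eq_or_lt with rfl | h
    · exact hx
    · exact hp i (Finset.mem_Icc.2 ⟨hi.1, by omega⟩)
  have hS : Gam p j * Real.log (p (j + 1)) ≤
      ∑ i ∈ Finset.Icc 1 j, p i * Real.log (p i) := by
    rw [Gam, Finset.sum_mul]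
    exact Finset.sum_le_sum fun i hi =>
      mul_le_mul_of_nonneg_left (Real.log_le_log hx (hle i hi)) (hp i hi).le
  rw [Hq_eq_log_sub p j hp hG, Hq_eq_log_sub p (j + 1) hp' hG',
    Finset.sum_Icc_succ_top (by omega), hsucc]
  rw [hsucc] at hG'
  have hlog : Real.log (Gam p j) < Real.log (Gam p j + p (j + 1)) :=
    Real.log_lt_log hG (by linarith)
  have hquot : (∑ i ∈ Finset.Icc 1 j, p i * Real.log (p i) +
      p (j + 1) * Real.log (p (j + 1))) / (Gam p j + p (j + 1)) ≤
      (∑ i ∈ Finset.Icc 1 j, p i * Real.log (p i)) / Gam p j := by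
    rw [div_le_div_iff₀ hG' hG]
    nlinarith [mul_le_mul_of_nonneg_left hS hx.le]
  linarith

/-- The entropies of the greedy prefix distributions are strictly increasing,
`H(q^1) < H(q^2) < … < H(q^n) = H(p)`, so `H(q^j) < H(p)` for every `j < n` and the
entropy is maximized only when all tokens are selected. Consequently, if `H(p) > 0`
and `0 < α < 1`, then some index `j ≤ n` has `H(q^j) > α H(p)`, and the greedy
algorithm terminates having selected a proper subset of `{1,…,n}`. -/
theorem greedy_terminates (n : ℕ) (hn : 2 ≤ n) (p : ℕ → ℝ)
    (hpos : ∀ i, 1 ≤ i → i ≤ n → 0 < p i)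
    (hdesc : ∀ i j, 1 ≤ i → i ≤ j → j ≤ n → p j ≤ p i)
    (hsum : ∑ i ∈ Finset.Icc 1 n, p i = 1) :
    (∀ j, 1 ≤ j → j < n → Hq p j < Hq p (j + 1)) ∧
    Hq p n = Hp p n ∧
    (∀ j, 1 ≤ j → j < n → Hq p j < Hp p n) ∧
    (0 < Hp p n → ∀ α : ℝ, 0 < α → α < 1 →
      ∃ j, 1 ≤ j ∧ j ≤ n ∧ α * Hp p n < Hq p j) := by
  have hstep : ∀ j, 1 ≤ j → j < n → Hq p j < Hq p (j + 1) := fun j hj hjn =>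
    Hq_lt_Hq_succ p j hj (hpos _ (by omega) hjn) fun i hi => by
      rw [Finset.mem_Icc] at hi
      exact hdesc i (j + 1) hi.1 (by omega) hjn
  have hfull : Hq p n = Hp p n := by
    have hG : Gam p n = 1 := hsum
    simp [Hq, Hp, hG]
  refine ⟨hstep, hfull, fun j hj hjn => ?_, fun hH α _ hα => ⟨n, by omega, le_rfl, ?_⟩⟩
  · have hmono : StrictMonoOn (Hq p) (Set.Icc 1 n) :=
      strictMonoOn_of_lt_add_one Set.ordConnected_Icc fun k _ hk hk' =>
        hstep k hk.1 (Nat.lt_of_succ_le hk'.2)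
    exact hfull ▸ hmono ⟨hj, hjn.le⟩ ⟨by omega, le_rfl⟩ hjn
  · rw [hfull]
    exact mul_lt_of_lt_one_left hH hα
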